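/- For every ζ ∈ (0,1) there exists α0 > 0 such that for every α ∈ (0, α0] there exist n0, r_min ∈ ℕ with the following property: for every n ≥ n0 and every integer r with r_min ≤ r ≤ (1−ζ)√n, if H is an n-vertex linear hypergraph such that every edge e satisfies r ≤ |e| ≤ (1+α)r, then the chromatic index of H is at most (1 − ζ/500)n. -/

import Mathlib

open Finset
open scoped Classical

/-- A hypergraph on vertex set `Fin n` is *linear* if any two distinct edges intersect in at
most one vertex. -/
def LinearHG {n : ℕ} (H : Finset (Finset (Fin n))) : Prop :=
  ∀ e ∈ H, ∀ f ∈ H, e ≠ f → (e ∩ f).card ≤ 1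

/-- `φ` is a proper edge-colouring of the hypergraph `H`. -/
def IsProperEC {n : ℕ} (H : Finset (Finset (Fin n))) (φ : Finset (Fin n) → ℕ) : Prop :=
  ∀ e ∈ H, ∀ f ∈ H, e ≠ f → (e ∩ f).Nonempty → φ e ≠ φ f

/-- The chromatic index of the hypergraph `H` is at most `k`. -/
def ChromIndexLE {n : ℕ} (H : Finset (Finset (Fin n))) (k : ℕ) : Prop :=
  ∃ φ : Finset (Fin n) → ℕ, (∀ e ∈ H, φ e < k) ∧ IsProperEC H φ


section LocallySparse

variable {V : Type*} [DecidableEq V]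

/-- The probability that a random subset of `R`, containing each element independently with
probability `p`, equals `S`. -/
noncomputable def bernoulliWeight (p : ℝ) (R S : Finset V) : ℝ :=
  p ^ #S * (1 - p) ^ #(R \ S)

/-- The ordered pairs of distinct non-adjacent neighbours of `v` inside `R`. -/
noncomputable def nonadjPairs (N : V → Finset V) (v : V) (R : Finset V) : Finset (V × V) :=
  ((N v ∩ R) ×ˢ (N v ∩ R)).filter (fun q => q.1 ≠ q.2 ∧ q.2 ∉ N q.1)

/-- The vertices of `S` without neighbours in `S`. -/
noncomputable def isolatedPart (N : V → Finset V) (S : Finset V) : Finset V :=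
  S.filter (fun u => Disjoint (N u) S)

lemma bernoulliWeight_nonneg {p : ℝ} (h0 : 0 ≤ p) (h1 : p ≤ 1) (R S : Finset V) :
    0 ≤ bernoulliWeight p R S :=
  mul_nonneg (pow_nonneg h0 _) (pow_nonneg (by linarith) _)

lemma sum_bernoulliWeight_mul_indicator (p : ℝ) {R A B : Finset V} (hA : A ⊆ R) (hB : B ⊆ R)
    (hAB : Disjoint A B) :
    ∑ S ∈ R.powerset, bernoulliWeight p R S * (if A ⊆ S ∧ Disjoint S B then 1 else 0) =
      p ^ #A * (1 - p) ^ #B := by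
  have key := Finset.prod_add (fun i => if i ∈ B then 0 else p)
    (fun i => if i ∈ A then 0 else 1 - p) R
  have lhs : ∏ i ∈ R, ((if i ∈ B then 0 else p) + (if i ∈ A then 0 else 1 - p)) =
      p ^ #A * (1 - p) ^ #B := by
    have : ∀ i ∈ R, ((if i ∈ B then 0 else p) + (if i ∈ A then 0 else 1 - p)) =
        (if i ∈ A then p else 1) * (if i ∈ B then 1 - p else 1) := by
      intro i _
      by_cases h1 : i ∈ A
      · have h2 : i ∉ B := Finset.disjoint_left.mp hAB h1
        simp [h1, h2]
      · by_cases h2 : i ∈ B <;> simp [h1, h2]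
    rw [Finset.prod_congr rfl this, Finset.prod_mul_distrib, Finset.prod_ite_mem,
      Finset.prod_ite_mem, Finset.inter_eq_right.mpr hA, Finset.inter_eq_right.mpr hB]
    simp
  rw [← lhs, key]
  refine Finset.sum_congr rfl fun S hS => ?_
  rw [Finset.mem_powerset] at hS
  by_cases hd : Disjoint S B
  · by_cases hs : A ⊆ S
    · rw [if_pos ⟨hs, hd⟩, mul_one, bernoulliWeight]
      congr 1
      · rw [Finset.prod_congr rfl (g := fun _ => p)]
        · simp
        · intro i hi
          simp [Finset.disjoint_left.mp hd hi]
      · rw [Finset.prod_congr rfl (g := fun _ => 1 - p)]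
        · simp
        · intro i hi
          rw [Finset.mem_sdiff] at hi
          rw [if_neg fun h => hi.2 (hs h)]
    · rw [if_neg fun h => hs h.1, mul_zero]
      obtain ⟨i, hiA, hiS⟩ := Finset.not_subset.mp hs
      rw [Finset.prod_eq_zero (i := i) (s := R \ S)
        (Finset.mem_sdiff.mpr ⟨hA hiA, hiS⟩) (by simp [hiA]), mul_zero]
  · rw [if_neg fun h => hd h.2, mul_zero]
    obtain ⟨i, hiS, hiB⟩ := Finset.not_disjoint_iff.mp hd
    rw [Finset.prod_eq_zero (i := i) (s := S) hiS (by simp [hiB]), zero_mul]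

lemma sum_bernoulliWeight (p : ℝ) (R : Finset V) :
    ∑ S ∈ R.powerset, bernoulliWeight p R S = 1 := by
  have := sum_bernoulliWeight_mul_indicator p (Finset.empty_subset R) (Finset.empty_subset R)
    (Finset.disjoint_empty_left _)
  simpa using this

lemma sum_bernoulliWeight_mul_mem (p : ℝ) {R : Finset V} {u : V} (hu : u ∈ R) :
    ∑ S ∈ R.powerset, bernoulliWeight p R S * (if u ∈ S then 1 else 0) = p := by
  have := sum_bernoulliWeight_mul_indicator p (Finset.singleton_subset_iff.mpr hu)
    (Finset.empty_subset R) (Finset.disjoint_empty_right _)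
  simpa using this

lemma exists_le_of_sum_bernoulliWeight_le {p c : ℝ} (h0 : 0 ≤ p) (h1 : p ≤ 1) {R : Finset V}
    {F : Finset V → ℝ} (h : ∑ S ∈ R.powerset, bernoulliWeight p R S * F S ≤ c) :
    ∃ S ⊆ R, F S ≤ c := by
  by_contra! hcon
  have hpos : ∃ S ∈ R.powerset, 0 < bernoulliWeight p R S := by
    by_contra! hn
    have := Finset.sum_nonpos hn
    rw [sum_bernoulliWeight] at this
    linarith
  obtain ⟨S, hS, hw⟩ := hpos
  have : ∑ S ∈ R.powerset, bernoulliWeight p R S * c <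
      ∑ S ∈ R.powerset, bernoulliWeight p R S * F S := by
    refine Finset.sum_lt_sum (fun T hT => ?_) ⟨S, hS, ?_⟩
    · exact mul_le_mul_of_nonneg_left (hcon T (Finset.mem_powerset.mp hT)).le
        (bernoulliWeight_nonneg h0 h1 _ _)
    · exact mul_lt_mul_of_pos_left (hcon S (Finset.mem_powerset.mp hS)) hw
  rw [← Finset.sum_mul, sum_bernoulliWeight] at this
  linarith

lemma isolatedPart_subset (N : V → Finset V) (S : Finset V) : isolatedPart N S ⊆ S :=
  Finset.filter_subset _ _

lemma notMem_of_mem_isolatedPart {N : V → Finset V} {S : Finset V} {u w : V}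
    (hu : u ∈ isolatedPart N S) (hw : w ∈ isolatedPart N S) : w ∉ N u := fun h =>
  Finset.disjoint_left.mp (Finset.mem_filter.mp hu).2 h (isolatedPart_subset N S hw)

lemma card_nonadjPairs_le (N : V → Finset V) (v : V) (R : Finset V) :
    #(nonadjPairs N v R) ≤ #(N v) * #(N v) := by
  refine (Finset.card_filter_le _ _).trans ?_
  rw [Finset.card_product]
  exact Nat.mul_le_mul (Finset.card_le_card Finset.inter_subset_left)
    (Finset.card_le_card Finset.inter_subset_left)

lemma nonadjPairs_mono (N : V → Finset V) (v : V) {R R' : Finset V} (h : R' ⊆ R) :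
    nonadjPairs N v R' ⊆ nonadjPairs N v R := by
  intro q hq
  simp only [nonadjPairs, Finset.mem_filter, Finset.mem_product, Finset.mem_inter] at hq ⊢
  exact ⟨⟨⟨hq.1.1.1, h hq.1.1.2⟩, hq.1.2.1, h hq.1.2.2⟩, hq.2⟩

lemma card_nonadjPairs_sub_le (N : V → Finset V) (v : V) {R I : Finset V} :
    (#(nonadjPairs N v R) : ℝ) - #(nonadjPairs N v (R \ I)) ≤ 2 * #(N v) * #(I ∩ N v) := by
  have hsub : nonadjPairs N v R ⊆ nonadjPairs N v (R \ I) ∪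
      ((I ∩ N v) ×ˢ N v ∪ N v ×ˢ (I ∩ N v)) := by
    intro q hq
    simp only [nonadjPairs, Finset.mem_filter, Finset.mem_product, Finset.mem_inter,
      Finset.mem_union, Finset.mem_sdiff] at hq ⊢
    tauto
  have h1 := (Finset.card_le_card hsub).trans (Finset.card_union_le _ _)
  have h2 := Finset.card_union_le ((I ∩ N v) ×ˢ N v) (N v ×ˢ (I ∩ N v))
  rw [Finset.card_product, Finset.card_product] at h2
  have h3 : #(nonadjPairs N v R) ≤ #(nonadjPairs N v (R \ I)) + 2 * #(N v) * #(I ∩ N v) := by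
    nlinarith
  have h4 : (#(nonadjPairs N v R) : ℝ) ≤
    #(nonadjPairs N v (R \ I)) + 2 * #(N v) * #(I ∩ N v) := by exact_mod_cast h3
  linarith

lemma card_nonadjPairs_sub_le_sum (N : V → Finset V) (v : V) {R I S : Finset V} (hIS : I ⊆ S) :
    (#(nonadjPairs N v R) : ℝ) - #(nonadjPairs N v (R \ I)) ≤
      ∑ q ∈ nonadjPairs N v R, ((if q.1 ∈ S then (1 : ℝ) else 0) + if q.2 ∈ S then 1 else 0) := by
  have h1 : (#(nonadjPairs N v (R \ I)) : ℝ) =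
      ∑ q ∈ nonadjPairs N v R, if q.1 ∉ I ∧ q.2 ∉ I then 1 else 0 := by
    rw [Finset.sum_boole]
    congr 2
    ext q
    simp only [nonadjPairs, Finset.mem_filter, Finset.mem_product, Finset.mem_inter,
      Finset.mem_sdiff]
    tauto
  have h2 : (#(nonadjPairs N v R) : ℝ) = ∑ q ∈ nonadjPairs N v R, 1 := by simp
  rw [h1, h2, ← Finset.sum_sub_distrib]
  refine Finset.sum_le_sum fun q _ => ?_
  have a1 : q.1 ∈ I → q.1 ∈ S := fun h => hIS h
  have a2 : q.2 ∈ I → q.2 ∈ S := fun h => hIS h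
  by_cases b1 : q.1 ∈ I <;> by_cases b2 : q.2 ∈ I <;> by_cases b3 : q.1 ∈ S <;>
    by_cases b4 : q.2 ∈ S <;> simp_all

lemma sum_indicator_le_two_mul_card {N : V → Finset V} (hirr : ∀ u, u ∉ N u)
    (hsymm : ∀ u w, u ∈ N w → w ∈ N u) (v : V) {R S : Finset V} (hS : S ⊆ R) :
    ∑ q ∈ nonadjPairs N v R, (if {q.1, q.2} ⊆ S ∧
      Disjoint S (((N q.1 ∪ N q.2 ∪ N v) ∩ R) \ {q.1, q.2}) then (1 : ℝ) else 0) ≤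
      2 * ((#(isolatedPart N S ∩ N v) - 1 : ℕ) : ℝ) := by
  rw [Finset.sum_boole]
  set F := (nonadjPairs N v R).filter fun q => {q.1, q.2} ⊆ S ∧
      Disjoint S (((N q.1 ∪ N q.2 ∪ N v) ∩ R) \ {q.1, q.2}) with hF
  rcases F.eq_empty_or_nonempty with h | ⟨⟨u, w⟩, h⟩
  · simp [h]
  have char : ∀ q ∈ F, isolatedPart N S ∩ N v = {q.1, q.2} ∧ q.1 ≠ q.2 := by
    rintro ⟨u, w⟩ hq
    simp only [hF, nonadjPairs, Finset.mem_filter, Finset.mem_product, Finset.mem_inter,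
      Finset.insert_subset_iff, Finset.singleton_subset_iff] at hq
    obtain ⟨⟨⟨⟨huv, huR⟩, hwv, hwR⟩, hne, hnadj⟩, ⟨huS, hwS⟩, hd⟩ := hq
    have hd' : ∀ x ∈ S, (x ∈ N u ∨ x ∈ N w) ∨ x ∈ N v → x = u ∨ x = w := by
      intro x hx hx'
      by_contra hxx
      refine Finset.disjoint_left.mp hd hx ?_
      simp only [Finset.mem_sdiff, Finset.mem_inter, Finset.mem_union, Finset.mem_insert,
        Finset.mem_singleton]
      exact ⟨⟨hx', hS hx⟩, hxx⟩
    refine ⟨?_, hne⟩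
    ext x
    simp only [Finset.mem_inter, isolatedPart, Finset.mem_filter, Finset.mem_insert,
      Finset.mem_singleton]
    constructor
    · rintro ⟨⟨hx, _⟩, hxv⟩
      exact hd' x hx (Or.inr hxv)
    · rintro (rfl | rfl)
      · refine ⟨⟨huS, Finset.disjoint_left.mpr fun y hy hyS => ?_⟩, huv⟩
        rcases hd' y hyS (Or.inl (Or.inl hy)) with rfl | rfl
        · exact hirr _ hy
        · exact hnadj hy
      · refine ⟨⟨hwS, Finset.disjoint_left.mpr fun y hy hyS => ?_⟩, hwv⟩
        rcases hd' y hyS (Or.inl (Or.inr hy)) with rfl | rfl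
        · exact hnadj (hsymm _ _ hy)
        · exact hirr _ hy
  obtain ⟨hI, hne⟩ := char _ h
  have hsub : F ⊆ {(u, w), (w, u)} := by
    rintro ⟨x, y⟩ hq
    obtain ⟨hI', hne'⟩ := char _ hq
    have e : ({u, w} : Finset V) = {x, y} := hI.symm.trans hI'
    have hx : x ∈ ({u, w} : Finset V) := by rw [e]; simp
    have hy : y ∈ ({u, w} : Finset V) := by rw [e]; simp
    simp only [Finset.mem_insert, Finset.mem_singleton] at hx hy
    simp only [Finset.mem_insert, Finset.mem_singleton, Prod.mk.injEq]
    simp only at hne'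
    rcases hx with rfl | rfl <;> rcases hy with rfl | rfl <;> simp_all
  have hc : #F ≤ 2 := (Finset.card_le_card hsub).trans Finset.card_le_two
  rw [hI, Finset.card_pair hne]
  norm_num
  exact_mod_cast hc

lemma sum_bernoulliWeight_mul_card_isolatedPart_le (N : V → Finset V) (v : V) (R : Finset V)
    {p Δ : ℝ} (hp0 : 0 ≤ p) (hp1 : p ≤ 1) (hN : (#(N v) : ℝ) ≤ Δ) :
    ∑ S ∈ R.powerset, bernoulliWeight p R S * (#(isolatedPart N S ∩ N v) : ℝ) ≤ p * Δ := by
  calc ∑ S ∈ R.powerset, bernoulliWeight p R S * (#(isolatedPart N S ∩ N v) : ℝ)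
      ≤ ∑ S ∈ R.powerset, bernoulliWeight p R S *
          ∑ u ∈ N v ∩ R, (if u ∈ S then (1 : ℝ) else 0) := by
        refine Finset.sum_le_sum fun S hS => mul_le_mul_of_nonneg_left ?_
          (bernoulliWeight_nonneg hp0 hp1 _ _)
        rw [Finset.sum_boole]
        refine Nat.cast_le.mpr (Finset.card_le_card fun u hu => ?_)
        rw [Finset.mem_inter] at hu
        have hu' := isolatedPart_subset N S hu.1
        exact Finset.mem_filter.mpr
          ⟨Finset.mem_inter.mpr ⟨hu.2, Finset.mem_powerset.mp hS hu'⟩, hu'⟩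
    _ = ∑ u ∈ N v ∩ R, ∑ S ∈ R.powerset,
          bernoulliWeight p R S * (if u ∈ S then (1 : ℝ) else 0) := by
        rw [Finset.sum_comm]
        exact Finset.sum_congr rfl fun S _ => Finset.mul_sum _ _ _
    _ = ∑ u ∈ N v ∩ R, p := Finset.sum_congr rfl fun u hu =>
        sum_bernoulliWeight_mul_mem p (Finset.mem_inter.mp hu).2
    _ ≤ p * Δ := by
        rw [Finset.sum_const, nsmul_eq_mul, mul_comm]
        refine mul_le_mul_of_nonneg_left (le_trans ?_ hN) hp0
        exact_mod_cast Finset.card_le_card Finset.inter_subset_left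

lemma sum_bernoulliWeight_mul_loss_le (N : V → Finset V) (v : V) (R : Finset V)
    {p : ℝ} (hp0 : 0 ≤ p) (hp1 : p ≤ 1) :
    ∑ S ∈ R.powerset, bernoulliWeight p R S *
      (((#(nonadjPairs N v R) : ℕ) : ℝ) - #(nonadjPairs N v (R \ isolatedPart N S))) ≤
      2 * p * #(nonadjPairs N v R) := by
  calc ∑ S ∈ R.powerset, bernoulliWeight p R S *
        ((#(nonadjPairs N v R) : ℝ) - #(nonadjPairs N v (R \ isolatedPart N S)))
      ≤ ∑ S ∈ R.powerset, bernoulliWeight p R S * ∑ q ∈ nonadjPairs N v R,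
          ((if q.1 ∈ S then (1 : ℝ) else 0) + if q.2 ∈ S then 1 else 0) :=
        Finset.sum_le_sum fun S _ => mul_le_mul_of_nonneg_left
          (card_nonadjPairs_sub_le_sum N v (isolatedPart_subset N S))
          (bernoulliWeight_nonneg hp0 hp1 _ _)
    _ = ∑ q ∈ nonadjPairs N v R, (∑ S ∈ R.powerset,
          bernoulliWeight p R S * (if q.1 ∈ S then (1 : ℝ) else 0) +
          ∑ S ∈ R.powerset, bernoulliWeight p R S * (if q.2 ∈ S then (1 : ℝ) else 0)) := by
        simp_rw [← Finset.sum_add_distrib, ← mul_add]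
        rw [Finset.sum_comm]
        exact Finset.sum_congr rfl fun S _ => Finset.mul_sum _ _ _
    _ = ∑ q ∈ nonadjPairs N v R, (p + p) := by
        refine Finset.sum_congr rfl fun q hq => ?_
        simp only [nonadjPairs, Finset.mem_filter, Finset.mem_product, Finset.mem_inter] at hq
        rw [sum_bernoulliWeight_mul_mem p hq.1.1.2, sum_bernoulliWeight_mul_mem p hq.1.2.2]
    _ = 2 * p * #(nonadjPairs N v R) := by
        rw [Finset.sum_const, nsmul_eq_mul]
        ring

lemma le_sum_bernoulliWeight_mul_repeats {N : V → Finset V} (hirr : ∀ u, u ∉ N u)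
    (hsymm : ∀ u w, u ∈ N w → w ∈ N u) (v : V) (R : Finset V) {p Δ : ℝ} (hp0 : 0 ≤ p)
    (hp1 : p ≤ 1) (hN : ∀ u, (#(N u) : ℝ) ≤ Δ) :
    p ^ 2 * (1 - 3 * p * Δ) / 2 * #(nonadjPairs N v R) ≤
      ∑ S ∈ R.powerset, bernoulliWeight p R S *
        ((#(isolatedPart N S ∩ N v) - 1 : ℕ) : ℝ) := by
  suffices h : p ^ 2 * (1 - 3 * p * Δ) * #(nonadjPairs N v R) ≤
      ∑ S ∈ R.powerset, bernoulliWeight p R S *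
        (2 * ((#(isolatedPart N S ∩ N v) - 1 : ℕ) : ℝ)) by
    have e : ∀ S, bernoulliWeight p R S * (2 * ((#(isolatedPart N S ∩ N v) - 1 : ℕ) : ℝ)) =
        2 * (bernoulliWeight p R S * ((#(isolatedPart N S ∩ N v) - 1 : ℕ) : ℝ)) :=
      fun S => by ring
    simp_rw [e] at h
    rw [← Finset.mul_sum] at h
    linarith
  calc p ^ 2 * (1 - 3 * p * Δ) * #(nonadjPairs N v R)
      = ∑ q ∈ nonadjPairs N v R, p ^ 2 * (1 - 3 * p * Δ) := by
        rw [Finset.sum_const, nsmul_eq_mul]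
        ring
    _ ≤ ∑ q ∈ nonadjPairs N v R, ∑ S ∈ R.powerset, bernoulliWeight p R S *
          (if {q.1, q.2} ⊆ S ∧
            Disjoint S (((N q.1 ∪ N q.2 ∪ N v) ∩ R) \ {q.1, q.2}) then (1 : ℝ) else 0) := by
        refine Finset.sum_le_sum fun q hq => ?_
        simp only [nonadjPairs, Finset.mem_filter, Finset.mem_product, Finset.mem_inter] at hq
        rw [sum_bernoulliWeight_mul_indicator p (Finset.insert_subset hq.1.1.2
            (Finset.singleton_subset_iff.mpr hq.1.2.2))
          (Finset.sdiff_subset.trans Finset.inter_subset_right) Finset.disjoint_sdiff,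
          Finset.card_pair hq.2.1]
        refine mul_le_mul_of_nonneg_left ?_ (sq_nonneg p)
        set B := ((N q.1 ∪ N q.2 ∪ N v) ∩ R) \ {q.1, q.2}
        have hB : (#B : ℝ) ≤ 3 * Δ := by
          have h1 : #B ≤ #(N q.1) + #(N q.2) + #(N v) :=
            (Finset.card_le_card (Finset.sdiff_subset.trans Finset.inter_subset_left)).trans
              ((Finset.card_union_le _ _).trans
                (Nat.add_le_add_right (Finset.card_union_le _ _) _))
          have h2 : (#B : ℝ) ≤ #(N q.1) + #(N q.2) + #(N v) := by exact_mod_cast h1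
          linarith [hN q.1, hN q.2, hN v]
        have h3 := one_add_mul_le_pow (a := -p) (by linarith) #B
        rw [← sub_eq_add_neg] at h3
        nlinarith
    _ = ∑ S ∈ R.powerset, bernoulliWeight p R S * ∑ q ∈ nonadjPairs N v R,
          (if {q.1, q.2} ⊆ S ∧
            Disjoint S (((N q.1 ∪ N q.2 ∪ N v) ∩ R) \ {q.1, q.2}) then (1 : ℝ) else 0) := by
        rw [Finset.sum_comm]
        exact Finset.sum_congr rfl fun S _ => (Finset.mul_sum _ _ _).symm
    _ ≤ _ := Finset.sum_le_sum fun S hS => mul_le_mul_of_nonneg_left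
        (sum_indicator_le_two_mul_card hirr hsymm v (Finset.mem_powerset.mp hS))
        (bernoulliWeight_nonneg hp0 hp1 _ _)

lemma exp_neg_le {x : ℝ} (h : |x| ≤ 1) : Real.exp (-x) ≤ 1 - x + x ^ 2 := by
  have := Real.abs_exp_sub_one_sub_id_le (x := -x) (by rwa [abs_neg])
  have := (abs_le.mp this).2
  nlinarith

lemma sum_bernoulliWeight_mul_exp_le {N : V → Finset V} (hirr : ∀ u, u ∉ N u)
    (hsymm : ∀ u w, u ∈ N w → w ∈ N u) (v : V) (R : Finset V) {p Δ κ κ' t M : ℝ}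
    (hp0 : 0 ≤ p) (hp1 : p ≤ 1) (hN : ∀ u, (#(N u) : ℝ) ≤ Δ) (hpΔ : p * Δ ≤ 1)
    (hκ0 : 0 ≤ κ') (hκΔ : 2 * κ' * Δ ≤ 1) (hκκ : κ' ≤ κ) (hκd : (κ - κ') * Δ ^ 2 ≤ 1)
    (hκ : κ ≤ p ^ 2 * (1 - 3 * p * Δ) / 2 + (1 - 2 * p) * κ')
    (hM : ∀ S ⊆ R, (#(isolatedPart N S ∩ N v) : ℝ) ≤ M) (ht : 0 ≤ t)
    (htM : t * (2 * M + 1) ≤ 1) :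
    ∑ S ∈ R.powerset, bernoulliWeight p R S *
      Real.exp (-t * (((#(isolatedPart N S ∩ N v) - 1 : ℕ) : ℝ) +
        κ' * #(nonadjPairs N v (R \ isolatedPart N S)) - κ * #(nonadjPairs N v R))) ≤
      1 + 3 * (2 * M + 1) * t ^ 2 := by
  have hΔ : 0 ≤ Δ := (Nat.cast_nonneg _).trans (hN v)
  have hM0 : 0 ≤ M := (Nat.cast_nonneg _).trans (hM ∅ (Finset.empty_subset _))
  set Z : ℝ := ((#(nonadjPairs N v R) : ℕ) : ℝ) with hZ
  have hZ0 : 0 ≤ Z := Nat.cast_nonneg _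
  have hZΔ : Z ≤ Δ ^ 2 := by
    have : (#(nonadjPairs N v R) : ℝ) ≤ #(N v) * #(N v) := by
      exact_mod_cast card_nonadjPairs_le N v R
    nlinarith [hN v, Nat.cast_nonneg (α := ℝ) #(N v)]
  set X : Finset V → ℝ := fun S => ((#(isolatedPart N S ∩ N v) : ℕ) : ℝ) with hX
  set Y : Finset V → ℝ := fun S => ((#(isolatedPart N S ∩ N v) - 1 : ℕ) : ℝ) with hY
  set L : Finset V → ℝ := fun S => Z - #(nonadjPairs N v (R \ isolatedPart N S)) with hL
  set D : Finset V → ℝ := fun S => Y S - κ' * L S - (κ - κ') * Z with hD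
  have hDeq : ∀ S, Y S + κ' * #(nonadjPairs N v (R \ isolatedPart N S)) - κ * Z = D S :=
    fun S => by simp only [hD, hL]; ring
  have hw := fun S => bernoulliWeight_nonneg hp0 hp1 R S
  have hX0 : ∀ S, 0 ≤ X S := fun S => Nat.cast_nonneg _
  have hY0 : ∀ S, 0 ≤ Y S := fun S => Nat.cast_nonneg _
  have hYX : ∀ S, Y S ≤ X S := fun S => Nat.cast_le.mpr (Nat.sub_le _ _)
  have hL0 : ∀ S, 0 ≤ L S := fun S => sub_nonneg.mpr
    (Nat.cast_le.mpr (Finset.card_le_card (nonadjPairs_mono N v Finset.sdiff_subset)))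
  have hLX : ∀ S, κ' * L S ≤ X S := by
    intro S
    have h1 : L S ≤ 2 * #(N v) * X S := card_nonadjPairs_sub_le N v
    have h2 : 2 * #(N v) * X S ≤ 2 * Δ * X S :=
      mul_le_mul_of_nonneg_right (by linarith [hN v]) (hX0 S)
    have h3 := mul_le_mul_of_nonneg_left (h1.trans h2) hκ0
    nlinarith [mul_le_mul_of_nonneg_right hκΔ (hX0 S)]
  have hdZ0 : 0 ≤ (κ - κ') * Z := mul_nonneg (by linarith) hZ0
  have hdZ : (κ - κ') * Z ≤ 1 :=
    (mul_le_mul_of_nonneg_left hZΔ (by linarith)).trans hκd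
  have hDabs : ∀ S, |D S| ≤ 2 * X S + 1 := by
    intro S
    rw [abs_le]
    have := mul_nonneg hκ0 (hL0 S)
    constructor <;> simp only [hD] <;> linarith [hX0 S, hY0 S, hYX S, hLX S]
  have hED : 0 ≤ ∑ S ∈ R.powerset, bernoulliWeight p R S * D S := by
    have e : ∀ S, bernoulliWeight p R S * D S = bernoulliWeight p R S * Y S -
        κ' * (bernoulliWeight p R S * L S) - bernoulliWeight p R S * ((κ - κ') * Z) :=
      fun S => by simp only [hD]; ring
    simp_rw [e]
    rw [Finset.sum_sub_distrib, Finset.sum_sub_distrib, ← Finset.mul_sum, ← Finset.sum_mul,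
      sum_bernoulliWeight]
    have h1 := le_sum_bernoulliWeight_mul_repeats hirr hsymm v R hp0 hp1 hN
    have h2 := sum_bernoulliWeight_mul_loss_le N v R hp0 hp1
    have h3 := mul_le_mul_of_nonneg_left h2 hκ0
    have h4 := mul_le_mul_of_nonneg_right hκ hZ0
    nlinarith
  have hEX := sum_bernoulliWeight_mul_card_isolatedPart_le N v R hp0 hp1 (hN v)
  have hterm : ∀ S ∈ R.powerset, bernoulliWeight p R S * Real.exp (-t * D S) ≤
      bernoulliWeight p R S - t * (bernoulliWeight p R S * D S) +
        t ^ 2 * (2 * M + 1) * (2 * (bernoulliWeight p R S * X S) + bernoulliWeight p R S) := by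
    intro S hS
    have hXM : X S ≤ M := hM S (Finset.mem_powerset.mp hS)
    have hDM : |D S| ≤ 2 * M + 1 := (hDabs S).trans (by linarith)
    have h1 : |t * D S| ≤ 1 := by
      rw [abs_mul, abs_of_nonneg ht]
      exact (mul_le_mul_of_nonneg_left hDM ht).trans htM
    have h2 := exp_neg_le h1
    have h3 : D S ^ 2 ≤ (2 * M + 1) * (2 * X S + 1) := by
      rw [← sq_abs, sq]
      exact mul_le_mul hDM (hDabs S) (abs_nonneg _) (by linarith)
    have h4 : Real.exp (-t * D S) ≤
        1 - t * D S + t ^ 2 * ((2 * M + 1) * (2 * X S + 1)) := by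
      rw [neg_mul]
      refine h2.trans ?_
      rw [mul_pow]
      linarith [mul_le_mul_of_nonneg_left h3 (sq_nonneg t)]
    refine (mul_le_mul_of_nonneg_left h4 (hw S)).trans (le_of_eq ?_)
    ring
  have hgoal : ∑ S ∈ R.powerset, bernoulliWeight p R S * Real.exp (-t * D S) ≤
      1 + 3 * (2 * M + 1) * t ^ 2 := by
    refine (Finset.sum_le_sum hterm).trans ?_
    rw [Finset.sum_add_distrib, Finset.sum_sub_distrib, ← Finset.mul_sum, ← Finset.mul_sum,
      Finset.sum_add_distrib, ← Finset.mul_sum, sum_bernoulliWeight]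
    have h1 : ∑ S ∈ R.powerset, bernoulliWeight p R S * X S ≤ 1 := hEX.trans hpΔ
    have h2 : 0 ≤ t ^ 2 * (2 * M + 1) := by positivity
    nlinarith [mul_nonneg ht hED, mul_le_mul_of_nonneg_left h1 h2]
  simpa only [← hDeq] using hgoal

lemma exists_coloring_of_partial {H R : Finset V} {N : V → Finset V} (hirr : ∀ u, u ∉ N u)
    (hsymm : ∀ u w, u ∈ N w → w ∈ N u) {f : V → ℕ} {k : ℕ}
    (hlt : ∀ u ∈ H \ R, f u < k) (hf : ∀ u ∈ H \ R, ∀ w ∈ H \ R, w ∈ N u → f u ≠ f w)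
    (hk : ∀ v ∈ R, #((N v \ R).image f) + #(N v ∩ R) < k) :
    ∃ g : V → ℕ, (∀ u ∈ H, g u < k) ∧ ∀ u ∈ H, ∀ w ∈ H, w ∈ N u → g u ≠ g w := by
  suffices h : ∀ Q : Finset V, Q ⊆ R → ∃ g : V → ℕ, (∀ u, u ∉ R → g u = f u) ∧
      (∀ u ∈ (H \ R) ∪ Q, g u < k) ∧
      ∀ u ∈ (H \ R) ∪ Q, ∀ w ∈ (H \ R) ∪ Q, w ∈ N u → g u ≠ g w by
    obtain ⟨g, _, h1, h2⟩ := h R subset_rfl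
    have hH : ∀ u ∈ H, u ∈ (H \ R) ∪ R := by
      intro u hu
      simp only [Finset.mem_union, Finset.mem_sdiff]
      tauto
    exact ⟨g, fun u hu => h1 u (hH u hu), fun u hu w hw => h2 u (hH u hu) w (hH w hw)⟩
  intro Q
  induction Q using Finset.induction_on with
  | empty =>
    intro _
    exact ⟨f, fun _ _ => rfl, by simpa using hlt, by simpa using hf⟩
  | insert x Q hx ih =>
    intro hQ
    rw [Finset.insert_subset_iff] at hQ
    obtain ⟨g, hg, h1, h2⟩ := ih hQ.2
    have hcard : #((N x \ R).image f ∪ (N x ∩ R).image g) < #(Finset.range k) := by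
      rw [Finset.card_range]
      refine lt_of_le_of_lt (Finset.card_union_le _ _) (lt_of_le_of_lt ?_ (hk x hQ.1))
      exact Nat.add_le_add_left Finset.card_image_le _
    obtain ⟨c, hck, hc⟩ := Finset.exists_mem_notMem_of_card_lt_card hcard
    have hcN : ∀ w ∈ N x, g w ≠ c := by
      rintro w hw rfl
      apply hc
      by_cases hwR : w ∈ R
      · exact Finset.mem_union_right _
          (Finset.mem_image_of_mem _ (Finset.mem_inter.mpr ⟨hw, hwR⟩))
      · refine Finset.mem_union_left _ ?_
        rw [hg w hwR]
        exact Finset.mem_image_of_mem _ (Finset.mem_sdiff.mpr ⟨hw, hwR⟩)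
    have hins : ∀ u ∈ (H \ R) ∪ insert x Q, u ≠ x → u ∈ (H \ R) ∪ Q := by
      intro u hu hux
      simp only [Finset.mem_union, Finset.mem_insert] at hu ⊢
      tauto
    refine ⟨Function.update g x c, fun u hu => ?_, fun u hu => ?_, fun u hu w hw huw => ?_⟩
    · have : u ≠ x := fun h => hu (h ▸ hQ.1)
      rw [Function.update_of_ne this, hg u hu]
    · by_cases hux : u = x
      · rw [hux, Function.update_self]
        exact Finset.mem_range.mp hck
      · rw [Function.update_of_ne hux]
        exact h1 u (hins u hu hux)
    · by_cases hux : u = x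
      · subst hux
        have hwu : w ≠ u := fun h => hirr u (h ▸ huw)
        rw [Function.update_self, Function.update_of_ne hwu]
        exact (hcN w huw).symm
      · rw [Function.update_of_ne hux]
        by_cases hwx : w = x
        · subst hwx
          rw [Function.update_self]
          exact hcN u (hsymm _ _ huw)
        · rw [Function.update_of_ne hwx]
          exact h2 u (hins u hu hux) w (hins w hw hwx) huw

/-- The number of colours saved at `v` by repetitions among its coloured neighbours, when
exactly the vertices outside `R` are coloured. -/
noncomputable def savedColors (N : V → Finset V) (R : Finset V) (f : V → ℕ) (v : V) : ℝ :=
  #(N v \ R) - #((N v \ R).image f)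

lemma le_savedColors_sdiff (N : V → Finset V) {R I : Finset V} (hI : I ⊆ R) (f : V → ℕ) (j : ℕ)
    (v : V) :
    savedColors N R f v + ((#(I ∩ N v) - 1 : ℕ) : ℝ) ≤
      savedColors N (R \ I) (fun u => if u ∈ I then j else f u) v := by
  have h1 : N v \ (R \ I) = (N v \ R) ∪ (I ∩ N v) := by
    ext u
    have := @hI u
    simp only [Finset.mem_sdiff, Finset.mem_union, Finset.mem_inter]
    tauto
  have hd : Disjoint (N v \ R) (I ∩ N v) := by
    rw [Finset.disjoint_left]
    intro u hu hu'
    exact (Finset.mem_sdiff.mp hu).2 (hI (Finset.mem_inter.mp hu').1)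
  have h2 : (N v \ R).image (fun u => if u ∈ I then j else f u) = (N v \ R).image f := by
    refine Finset.image_congr fun u hu => ?_
    have : u ∉ I := fun h => (Finset.mem_sdiff.mp hu).2 (hI h)
    simp [this]
  have h3 : #((I ∩ N v).image (fun u => if u ∈ I then j else f u)) + (#(I ∩ N v) - 1) ≤
      #(I ∩ N v) := by
    rcases (I ∩ N v).eq_empty_or_nonempty with h | h
    · simp [h]
    · have : (I ∩ N v).image (fun u => if u ∈ I then j else f u) ⊆ {j} := by
        intro c hc
        obtain ⟨u, hu, rfl⟩ := Finset.mem_image.mp hc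
        simp [(Finset.mem_inter.mp hu).1]
      have := Finset.card_le_card this
      have := h.card_pos
      rw [Finset.card_singleton] at *
      omega
  have h4 := Finset.card_union_le ((N v \ R).image f)
    ((I ∩ N v).image (fun u => if u ∈ I then j else f u))
  unfold savedColors
  rw [h1, Finset.image_union, h2, Finset.card_union_of_disjoint hd]
  have h5 : (#((N v \ R).image f ∪ (I ∩ N v).image (fun u => if u ∈ I then j else f u)) : ℝ) ≤
      #((N v \ R).image f) + #((I ∩ N v).image (fun u => if u ∈ I then j else f u)) := by
    exact_mod_cast h4
  have h6 : (#((I ∩ N v).image (fun u => if u ∈ I then j else f u)) : ℝ) +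
      ((#(I ∩ N v) - 1 : ℕ) : ℝ) ≤ #(I ∩ N v) := by exact_mod_cast h3
  push_cast
  linarith

lemma exists_isolatedPart_sum_exp_le {N : V → Finset V} (hirr : ∀ u, u ∉ N u)
    (hsymm : ∀ u w, u ∈ N w → w ∈ N u) (R W : Finset V) (c : V → ℝ) {p Δ κ κ' t M : ℝ}
    (hp0 : 0 ≤ p) (hp1 : p ≤ 1) (hN : ∀ u, (#(N u) : ℝ) ≤ Δ) (hpΔ : p * Δ ≤ 1)
    (hκ0 : 0 ≤ κ') (hκΔ : 2 * κ' * Δ ≤ 1) (hκκ : κ' ≤ κ) (hκd : (κ - κ') * Δ ^ 2 ≤ 1)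
    (hκ : κ ≤ p ^ 2 * (1 - 3 * p * Δ) / 2 + (1 - 2 * p) * κ')
    (hM : ∀ v, ∀ S ⊆ R, (#(isolatedPart N S ∩ N v) : ℝ) ≤ M) (ht : 0 ≤ t)
    (htM : t * (2 * M + 1) ≤ 1) :
    ∃ S ⊆ R, ∑ v ∈ W, Real.exp (-t * (c v + ((#(isolatedPart N S ∩ N v) - 1 : ℕ) : ℝ) +
        κ' * #(nonadjPairs N v (R \ isolatedPart N S)))) ≤
      (1 + 3 * (2 * M + 1) * t ^ 2) *
        ∑ v ∈ W, Real.exp (-t * (c v + κ * #(nonadjPairs N v R))) := by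
  refine exists_le_of_sum_bernoulliWeight_le hp0 hp1 ?_
  simp_rw [Finset.mul_sum]
  rw [Finset.sum_comm]
  refine Finset.sum_le_sum fun v _ => ?_
  have key := sum_bernoulliWeight_mul_exp_le hirr hsymm v R hp0 hp1 hN hpΔ hκ0 hκΔ hκκ hκd hκ
    (hM v) ht htM
  refine le_trans (le_of_eq ?_) (mul_le_mul_of_nonneg_right key (Real.exp_nonneg _))
  rw [Finset.sum_mul]
  refine Finset.sum_congr rfl fun S _ => ?_
  rw [mul_assoc, ← Real.exp_add]
  congr 2
  ring

lemma exists_partial_coloring {H W : Finset V} {N : V → Finset V} (hNH : ∀ u, N u ⊆ H)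
    (hirr : ∀ u, u ∉ N u) (hsymm : ∀ u w, u ∈ N w → w ∈ N u) {p Δ t M : ℝ} {κ : ℕ → ℝ} {m : ℕ}
    (hp0 : 0 ≤ p) (hp1 : p ≤ 1) (hN : ∀ u, (#(N u) : ℝ) ≤ Δ) (hpΔ : p * Δ ≤ 1)
    (hκ0 : ∀ j < m, 0 ≤ κ (j + 1)) (hκΔ : ∀ j < m, 2 * κ (j + 1) * Δ ≤ 1)
    (hκκ : ∀ j < m, κ (j + 1) ≤ κ j) (hκd : ∀ j < m, (κ j - κ (j + 1)) * Δ ^ 2 ≤ 1)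
    (hκ : ∀ j < m, κ j ≤ p ^ 2 * (1 - 3 * p * Δ) / 2 + (1 - 2 * p) * κ (j + 1))
    (hM : ∀ v, ∀ S ⊆ H, (#(isolatedPart N S ∩ N v) : ℝ) ≤ M) (hM0 : 0 ≤ M) (ht : 0 ≤ t)
    (htM : t * (2 * M + 1) ≤ 1) :
    ∀ j ≤ m, ∃ R ⊆ H, ∃ f : V → ℕ, (∀ u ∈ H \ R, f u < j) ∧
      (∀ u ∈ H \ R, ∀ w ∈ H \ R, w ∈ N u → f u ≠ f w) ∧
      ∑ v ∈ W, Real.exp (-t * (savedColors N R f v + κ j * #(nonadjPairs N v R))) ≤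
        (1 + 3 * (2 * M + 1) * t ^ 2) ^ j *
          ∑ v ∈ W, Real.exp (-t * (κ 0 * #(nonadjPairs N v H))) := by
  intro j
  induction j with
  | zero =>
    intro _
    refine ⟨H, subset_rfl, fun _ => 0, by simp, by simp, ?_⟩
    simp only [savedColors, Finset.sdiff_eq_empty_iff_subset.mpr (hNH _)]
    simp
  | succ j ih =>
    intro hj
    obtain ⟨R, hR, f, hlt, hf, hsum⟩ := ih (by omega)
    obtain ⟨S, hS, hSsum⟩ := exists_isolatedPart_sum_exp_le hirr hsymm R W (savedColors N R f)
      hp0 hp1 hN hpΔ (hκ0 j hj) (hκΔ j hj) (hκκ j hj) (hκd j hj) (hκ j hj)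
      (fun v S hS => hM v S (hS.trans hR)) ht htM
    have hI := (isolatedPart_subset N S).trans hS
    have hcase : ∀ u ∈ H \ (R \ isolatedPart N S), u ∉ isolatedPart N S → u ∈ H \ R := by
      intro u hu huI
      simp only [Finset.mem_sdiff] at hu ⊢
      tauto
    refine ⟨R \ isolatedPart N S, Finset.sdiff_subset.trans hR,
      fun u => if u ∈ isolatedPart N S then j else f u, fun u hu => ?_,
      fun u hu w hw huw => ?_, ?_⟩
    · by_cases huI : u ∈ isolatedPart N S
      · simp [huI]
      · simpa [huI] using (hlt u (hcase u hu huI)).trans (Nat.lt_succ_self j)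
    · by_cases huI : u ∈ isolatedPart N S <;> by_cases hwI : w ∈ isolatedPart N S
      · exact absurd huw (notMem_of_mem_isolatedPart huI hwI)
      · simpa [huI, hwI] using (hlt w (hcase w hw hwI)).ne'
      · simpa [huI, hwI] using (hlt u (hcase u hu huI)).ne
      · simpa [huI, hwI] using hf u (hcase u hu huI) w (hcase w hw hwI) huw
    · calc _ ≤ ∑ v ∈ W, Real.exp (-t * (savedColors N R f v +
              ((#(isolatedPart N S ∩ N v) - 1 : ℕ) : ℝ) +
              κ (j + 1) * #(nonadjPairs N v (R \ isolatedPart N S)))) := by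
            refine Finset.sum_le_sum fun v _ => Real.exp_le_exp.mpr ?_
            refine mul_le_mul_of_nonpos_left ?_ (neg_nonpos.mpr ht)
            linarith [le_savedColors_sdiff N hI f j v]
        _ ≤ _ := hSsum
        _ ≤ _ := mul_le_mul_of_nonneg_left hsum (by positivity)
        _ = _ := by ring

/-- A graph of maximum degree at most `Δ`, given by its neighbourhoods `N`, is `k`-colourable
if every vertex of degree at least `k` has many non-adjacent pairs of neighbours. -/
lemma exists_coloring_of_locally_sparse {H : Finset V} {N : V → Finset V}
    (hNH : ∀ u, N u ⊆ H) (hirr : ∀ u, u ∉ N u) (hsymm : ∀ u w, u ∈ N w → w ∈ N u)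
    {p Δ t M g z : ℝ} {k : ℕ} (hp0 : 0 ≤ p) (hN : ∀ u, (#(N u) : ℝ) ≤ Δ) (hΔ : 1 ≤ Δ)
    (hpΔ : 3 * p * Δ ≤ 1) (hkΔ : k ≤ Δ)
    (hM : ∀ v, ∀ S ⊆ H, (#(isolatedPart N S ∩ N v) : ℝ) ≤ M) (hM0 : 0 ≤ M) (ht : 0 ≤ t)
    (htM : t * (2 * M + 1) ≤ 1)
    (hz : ∀ v ∈ H, k ≤ #(N v) → z ≤ #(nonadjPairs N v H))
    (hg : ∀ v ∈ H, (#(N v) : ℝ) < k + g)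
    (hlt : #H * Real.exp (3 * (2 * M + 1) * t ^ 2 * k + t * g -
      t * (p ^ 2 * (1 - 3 * p * Δ) / 2 * (1 - 2 * p * k) * k * z)) < 1) :
    ∃ φ : V → ℕ, (∀ u ∈ H, φ u < k) ∧ ∀ u ∈ H, ∀ w ∈ H, w ∈ N u → φ u ≠ φ w := by
  set b := p ^ 2 * (1 - 3 * p * Δ) / 2 with hb
  set q := 1 - 2 * p * k with hq
  set W := H.filter fun v => k ≤ #(N v) with hW
  have hk0 : (0 : ℝ) ≤ k := Nat.cast_nonneg k
  have hpΔ0 : 0 ≤ p * Δ := by positivity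
  have hpk : p * k ≤ p * Δ := mul_le_mul_of_nonneg_left hkΔ hp0
  have hpk0 : 0 ≤ p * k := by positivity
  have hq0 : 0 ≤ q := by rw [hq]; linarith
  have hq1 : q ≤ 1 := by rw [hq]; linarith
  have hp1 : p ≤ 1 := by nlinarith
  have hb0 : 0 ≤ b := by
    have : 0 ≤ 1 - 3 * p * Δ := by linarith
    positivity
  have hbp : b ≤ p ^ 2 / 2 := by
    rw [hb]
    nlinarith [mul_nonneg (sq_nonneg p) hpΔ0]
  have hbq : b * q ≤ b := mul_le_of_le_one_right hb0 hq1
  have hbq0 : 0 ≤ b * q := mul_nonneg hb0 hq0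
  have hcast : ∀ j < k, 0 ≤ (k : ℝ) - (j + 1) := by
    intro j hj
    have : ((j + 1 : ℕ) : ℝ) ≤ k := Nat.cast_le.mpr hj
    push_cast at this
    linarith
  have hpΔ2 : p ^ 2 * Δ ^ 2 ≤ 1 := by
    rw [← mul_pow]
    exact pow_le_one₀ hpΔ0 (by linarith)
  obtain ⟨R, hR, f, hflt, hf, hsum⟩ := exists_partial_coloring (H := H) (W := W)
    (κ := fun j => b * q * (k - j)) (m := k) hNH hirr hsymm hp0 hp1 hN (by linarith)
    (fun j hj => by
      push_cast
      exact mul_nonneg hbq0 (hcast j hj))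
    (fun j hj => by
      push_cast
      have h1 : b * q * ((k : ℝ) - (j + 1)) ≤ p ^ 2 / 2 * Δ :=
        mul_le_mul (hbq.trans hbp)
          (by linarith [Nat.cast_nonneg (α := ℝ) j]) (hcast j hj) (by positivity)
      nlinarith [mul_le_mul_of_nonneg_right h1 (by linarith : (0 : ℝ) ≤ Δ)])
    (fun j hj => by
      push_cast
      nlinarith)
    (fun j hj => by
      push_cast
      have : b * q * ((k : ℝ) - j) - b * q * (k - (j + 1)) = b * q := by ring
      rw [this]
      nlinarith [mul_le_mul_of_nonneg_right (hbq.trans hbp) (sq_nonneg Δ)])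
    (fun j hj => by
      push_cast
      rw [← hb]
      have hx := hcast j hj
      have h1 : q * (1 + 2 * p * ((k : ℝ) - (j + 1))) ≤ 1 := by
        have h2 : 1 + 2 * p * ((k : ℝ) - (j + 1)) ≤ 1 + 2 * p * k := by
          nlinarith [Nat.cast_nonneg (α := ℝ) j]
        have h3 := mul_le_mul_of_nonneg_left h2 hq0
        rw [hq] at h3 ⊢
        nlinarith [mul_nonneg hpk0 hpk0]
      nlinarith [mul_le_mul_of_nonneg_left h1 hb0])
    hM hM0 ht htM k le_rfl
  have hsaved : ∀ v ∈ W, g < savedColors N R f v := by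
    intro v hv
    by_contra! hle
    have hA : 1 + 3 * (2 * M + 1) * t ^ 2 ≤ Real.exp (3 * (2 * M + 1) * t ^ 2) := by
      linarith [Real.add_one_le_exp (3 * (2 * M + 1) * t ^ 2)]
    have h1 : Real.exp (-t * g) ≤
        ∑ v ∈ W, Real.exp (-t * (savedColors N R f v +
          b * q * (k - (k : ℕ)) * #(nonadjPairs N v R))) := by
      refine le_trans ?_ (Finset.single_le_sum (fun v _ => (Real.exp_pos _).le) hv)
      refine Real.exp_le_exp.mpr ?_
      rw [sub_self, mul_zero, zero_mul, add_zero]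
      exact mul_le_mul_of_nonpos_left hle (neg_nonpos.mpr ht)
    have h2 : ∑ v ∈ W, Real.exp (-t * (b * q * (k - ((0 : ℕ) : ℝ)) * #(nonadjPairs N v H))) ≤
        #H * Real.exp (-t * (b * q * k * z)) := by
      calc _ ≤ ∑ v ∈ W, Real.exp (-t * (b * q * k * z)) := by
            refine Finset.sum_le_sum fun v hv => Real.exp_le_exp.mpr ?_
            refine mul_le_mul_of_nonpos_left ?_ (neg_nonpos.mpr ht)
            rw [hW, Finset.mem_filter] at hv
            rw [Nat.cast_zero, sub_zero]
            exact mul_le_mul_of_nonneg_left (hz v hv.1 hv.2) (mul_nonneg hbq0 hk0)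
        _ ≤ _ := by
            rw [Finset.sum_const, nsmul_eq_mul]
            refine mul_le_mul_of_nonneg_right ?_ (Real.exp_nonneg _)
            exact_mod_cast Finset.card_filter_le _ _
    have h3 : (1 + 3 * (2 * M + 1) * t ^ 2) ^ k ≤
        Real.exp (3 * (2 * M + 1) * t ^ 2 * k) := by
      rw [mul_comm _ (k : ℝ), Real.exp_nat_mul]
      exact pow_le_pow_left₀ (by positivity) hA k
    have h4 := h1.trans (hsum.trans (mul_le_mul h3 h2
      (Finset.sum_nonneg fun v _ => (Real.exp_pos _).le) (Real.exp_nonneg _)))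
    have h5 : Real.exp (t * g) * Real.exp (-t * g) = 1 := by
      rw [← Real.exp_add]
      simp
    have h6 := mul_le_mul_of_nonneg_left h4 (Real.exp_nonneg (t * g))
    rw [h5] at h6
    have h7 : Real.exp (t * g) * (Real.exp (3 * (2 * M + 1) * t ^ 2 * k) *
        (#H * Real.exp (-t * (b * q * k * z)))) = #H * Real.exp (3 * (2 * M + 1) * t ^ 2 * k +
        t * g - t * (b * q * k * z)) := by
      rw [sub_eq_add_neg, Real.exp_add, Real.exp_add, neg_mul]
      ring
    rw [h7] at h6
    linarith
  refine exists_coloring_of_partial hirr hsymm hflt hf fun v hv => ?_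
  have hcard := Finset.card_sdiff_add_card_inter (N v) R
  by_cases hvk : k ≤ #(N v)
  · have h1 := hsaved v (Finset.mem_filter.mpr ⟨hR hv, hvk⟩)
    have h2 := hg v (hR hv)
    unfold savedColors at h1
    have h3 : (#(N v \ R) : ℝ) + #(N v ∩ R) = #(N v) := by exact_mod_cast hcard
    have h4 : (#((N v \ R).image f) : ℝ) + #(N v ∩ R) < k := by linarith
    exact_mod_cast h4
  · have := Finset.card_image_le (s := N v \ R) (f := f)
    omega

end LocallySparse

section LineGraph

variable {n : ℕ}

/-- The edges of `H` other than `e` that meet `e`; empty unless `e` is an edge of `H`. -/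
noncomputable def lineNeighbors (H : Finset (Finset (Fin n))) (e : Finset (Fin n)) :
    Finset (Finset (Fin n)) :=
  H.filter fun f => e ∈ H ∧ f ≠ e ∧ (e ∩ f).Nonempty

/-- The edges of `H` through `x`. -/
noncomputable def edgesThrough (H : Finset (Finset (Fin n))) (x : Fin n) :
    Finset (Finset (Fin n)) :=
  H.filter fun f => x ∈ f

variable {H : Finset (Finset (Fin n))}

lemma mem_lineNeighbors {e f : Finset (Fin n)} :
    f ∈ lineNeighbors H e ↔ f ∈ H ∧ e ∈ H ∧ f ≠ e ∧ (e ∩ f).Nonempty :=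
  Finset.mem_filter

lemma lineNeighbors_symm {e f : Finset (Fin n)} (h : e ∈ lineNeighbors H f) :
    f ∈ lineNeighbors H e := by
  rw [mem_lineNeighbors] at h ⊢
  exact ⟨h.2.1, h.1, h.2.2.1.symm, Finset.inter_comm f e ▸ h.2.2.2⟩

lemma LinearHG.eq_of_mem (hH : LinearHG H) {e f : Finset (Fin n)} (he : e ∈ H) (hf : f ∈ H)
    {x y : Fin n} (hxy : x ≠ y) (hxe : x ∈ e) (hye : y ∈ e) (hxf : x ∈ f) (hyf : y ∈ f) :
    e = f := by
  by_contra hne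
  exact hxy (Finset.card_le_one.mp (hH e he f hf hne) x (Finset.mem_inter.mpr ⟨hxe, hxf⟩) y
    (Finset.mem_inter.mpr ⟨hye, hyf⟩))

lemma LinearHG.card_edgesThrough_mul_le (hH : LinearHG H) {r : ℕ} (hr : ∀ e ∈ H, r ≤ #e)
    (x : Fin n) : #(edgesThrough H x) * (r - 1) ≤ n := by
  have hd : ((edgesThrough H x : Finset (Finset (Fin n))) : Set (Finset (Fin n))).PairwiseDisjoint
      fun f => f.erase x := by
    intro e he f hf hne
    rw [Finset.mem_coe, edgesThrough, Finset.mem_filter] at he hf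
    refine Finset.disjoint_left.mpr fun y hy hy' => hne ?_
    rw [Finset.mem_erase] at hy hy'
    exact hH.eq_of_mem he.1 hf.1 hy.1.symm he.2 hy.2 hf.2 hy'.2
  calc #(edgesThrough H x) * (r - 1) ≤ ∑ f ∈ edgesThrough H x, #(f.erase x) := by
        rw [← smul_eq_mul]
        refine Finset.card_nsmul_le_sum _ _ _ fun f hf => ?_
        rw [edgesThrough, Finset.mem_filter] at hf
        rw [Finset.card_erase_of_mem hf.2]
        exact Nat.sub_le_sub_right (hr f hf.1) 1
    _ = #((edgesThrough H x).biUnion fun f => f.erase x) := (Finset.card_biUnion hd).symm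
    _ ≤ n := (Finset.card_le_univ _).trans (Fintype.card_fin n).le

lemma card_lineNeighbors_le {d : ℕ} (hd : ∀ x, #(edgesThrough H x) ≤ d) (e : Finset (Fin n)) :
    #(lineNeighbors H e) ≤ #e * d := by
  refine le_trans (Finset.card_le_card fun f hf => ?_)
    (Finset.card_biUnion_le_card_mul e (edgesThrough H) d fun x _ => hd x)
  obtain ⟨hfH, _, _, x, hx⟩ := mem_lineNeighbors.mp hf
  rw [Finset.mem_inter] at hx
  exact Finset.mem_biUnion.mpr ⟨x, hx.1, Finset.mem_filter.mpr ⟨hfH, hx.2⟩⟩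

lemma card_le_mul_of_edgesThrough_le {d : ℕ} (hd : ∀ x, #(edgesThrough H x) ≤ d)
    (hne : ∀ e ∈ H, e.Nonempty) : #H ≤ n * d := by
  refine le_trans (Finset.card_le_card fun f hf => ?_)
    ((Finset.card_biUnion_le_card_mul Finset.univ (edgesThrough H) d fun x _ => hd x).trans
      (by simp))
  obtain ⟨x, hx⟩ := hne f hf
  exact Finset.mem_biUnion.mpr ⟨x, Finset.mem_univ x, Finset.mem_filter.mpr ⟨hf, hx⟩⟩

lemma card_isolatedPart_inter_lineNeighbors_le {S : Finset (Finset (Fin n))} (hS : S ⊆ H)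
    (e : Finset (Fin n)) : #(isolatedPart (lineNeighbors H) S ∩ lineNeighbors H e) ≤ #e := by
  refine Finset.card_le_card_of_forall_subsingleton (fun f x => x ∈ f) (fun f hf => ?_) ?_
  · obtain ⟨_, _, _, x, hx⟩ := mem_lineNeighbors.mp (Finset.mem_inter.mp hf).2
    rw [Finset.mem_inter] at hx
    exact ⟨x, hx.1, hx.2⟩
  · rintro x _ f ⟨hf, hxf⟩ f' ⟨hf', hxf'⟩
    by_contra hne
    have h := (Finset.mem_inter.mp hf).1
    have h' := (Finset.mem_inter.mp hf').1
    refine notMem_of_mem_isolatedPart h h' (mem_lineNeighbors.mpr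
      ⟨hS (isolatedPart_subset _ _ h'), hS (isolatedPart_subset _ _ h), fun h => hne h.symm, x,
        Finset.mem_inter.mpr ⟨hxf, hxf'⟩⟩)

lemma LinearHG.card_common_lineNeighbors_le (hH : LinearHG H) {d : ℕ}
    (hd : ∀ x, #(edgesThrough H x) ≤ d) {e f : Finset (Fin n)} (hf : f ∈ lineNeighbors H e) :
    #(lineNeighbors H e ∩ insert f (lineNeighbors H f)) ≤ d + #e * #f := by
  obtain ⟨hfH, heH, hfe, x, hx⟩ := mem_lineNeighbors.mp hf
  rw [Finset.mem_inter] at hx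
  set P := (e ×ˢ f).biUnion fun y =>
    H.filter fun w => y.1 ≠ y.2 ∧ y.1 ∈ w ∧ y.2 ∈ w with hP
  have hPcard : #P ≤ #e * #f := by
    rw [← Finset.card_product, ← mul_one #(e ×ˢ f)]
    refine Finset.card_biUnion_le_card_mul _ _ _ fun y _ => Finset.card_le_one.mpr ?_
    intro w hw w' hw'
    rw [Finset.mem_filter] at hw hw'
    exact hH.eq_of_mem hw.1 hw'.1 hw.2.1 hw.2.2.1 hw.2.2.2 hw'.2.2.1 hw'.2.2.2
  have hsub : lineNeighbors H e ∩ insert f (lineNeighbors H f) ⊆ edgesThrough H x ∪ P := by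
    intro w hw
    rw [Finset.mem_inter, Finset.mem_insert] at hw
    obtain ⟨hwH, _, _, y, hy⟩ := mem_lineNeighbors.mp hw.1
    rw [Finset.mem_inter] at hy
    by_cases hxw : x ∈ w
    · exact Finset.mem_union_left _ (Finset.mem_filter.mpr ⟨hwH, hxw⟩)
    · rcases hw.2 with rfl | hw2
      · exact absurd hx.2 hxw
      obtain ⟨_, _, _, y', hy'⟩ := mem_lineNeighbors.mp hw2
      rw [Finset.mem_inter] at hy'
      refine Finset.mem_union_right _ (Finset.mem_biUnion.mpr ⟨(y, y'),
        Finset.mem_product.mpr ⟨hy.1, hy'.1⟩, Finset.mem_filter.mpr ⟨hwH, ?_, hy.2, hy'.2⟩⟩)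
      rintro (rfl : y = y')
      have hyx : y ≠ x := fun h => hxw (h ▸ hy.2)
      exact hfe (hH.eq_of_mem hfH heH hyx hy'.1 hx.2 hy.1 hx.1)
  calc _ ≤ _ := Finset.card_le_card hsub
    _ ≤ _ := Finset.card_union_le _ _
    _ ≤ _ := Nat.add_le_add (hd x) hPcard

lemma LinearHG.le_card_nonadjPairs (hH : LinearHG H) {d m : ℕ}
    (hd : ∀ x, #(edgesThrough H x) ≤ d) (hm : ∀ e ∈ H, #e ≤ m) {e : Finset (Fin n)}
    (he : e ∈ H) : (#(lineNeighbors H e) : ℝ) * (#(lineNeighbors H e) - (d + m * m)) ≤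
      #(nonadjPairs (lineNeighbors H) e H) := by
  have hinter : lineNeighbors H e ∩ H = lineNeighbors H e :=
    Finset.inter_eq_left.mpr (Finset.filter_subset _ _)
  rw [nonadjPairs, hinter, Finset.card_filter, Finset.sum_product, Nat.cast_sum, ← nsmul_eq_mul]
  refine Finset.card_nsmul_le_sum _ _ _ fun f hf => ?_
  rw [← Finset.card_filter]
  have h1 : (lineNeighbors H e).filter (fun w => f ≠ w ∧ w ∉ lineNeighbors H f) =
      lineNeighbors H e \ insert f (lineNeighbors H f) := by
    ext w
    simp only [Finset.mem_filter, Finset.mem_sdiff, Finset.mem_insert, not_or]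
    exact ⟨fun h => ⟨h.1, Ne.symm h.2.1, h.2.2⟩, fun h => ⟨h.1, Ne.symm h.2.1, h.2.2⟩⟩
  have h2 := hH.card_common_lineNeighbors_le hd hf
  have h3 : #e * #f ≤ m * m :=
    Nat.mul_le_mul (hm e he) (hm f (mem_lineNeighbors.mp hf).1)
  have h4 := Finset.card_sdiff_add_card_inter (lineNeighbors H e)
    (insert f (lineNeighbors H f))
  have h5 : #(lineNeighbors H e) ≤
      #(lineNeighbors H e \ insert f (lineNeighbors H f)) + (d + m * m) := by omega
  have h6 : (#(lineNeighbors H e) : ℝ) ≤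
      #(lineNeighbors H e \ insert f (lineNeighbors H f)) + (d + m * m) := by exact_mod_cast h5
  rw [h1]
  linarith

end LineGraph

lemma sq_mul_exp_neg_sqrt_lt_one {δ x : ℝ} (hδ : 0 < δ) (hx : 0 < x)
    (h : (120 / δ ^ 5) ^ 2 < x) : x ^ 2 * Real.exp (-(δ * Real.sqrt x)) < 1 := by
  have hs : 0 < Real.sqrt x := Real.sqrt_pos.mpr hx
  have h1 : 120 / δ ^ 5 < Real.sqrt x := Real.lt_sqrt_of_sq_lt h
  rw [div_lt_iff₀ (by positivity)] at h1
  have h2 := Real.pow_div_factorial_le_exp (x := δ * Real.sqrt x) (by positivity) 5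
  have h3 : x ^ 2 < Real.exp (δ * Real.sqrt x) := by
    refine lt_of_lt_of_le ?_ h2
    rw [lt_div_iff₀ (by positivity)]
    have h4 : x ^ 2 = Real.sqrt x ^ 4 := by
      rw [show (4 : ℕ) = 2 * 2 from rfl, pow_mul, Real.sq_sqrt hx.le]
    have h5 : (Nat.factorial 5 : ℝ) = 120 := by norm_num [Nat.factorial]
    rw [h4, h5]
    have h6 : (0 : ℝ) < Real.sqrt x ^ 4 := by positivity
    calc Real.sqrt x ^ 4 * 120 < Real.sqrt x ^ 4 * (Real.sqrt x * δ ^ 5) :=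
          mul_lt_mul_of_pos_left h1 h6
      _ = (δ * Real.sqrt x) ^ 5 := by ring
  rw [Real.exp_neg, ← div_eq_mul_inv, div_lt_one (Real.exp_pos _)]
  exact h3

section Parameters

variable {n : ℕ}

lemma exponent_le {ζ x s k : ℝ} (hζ0 : 0 < ζ) (hs : 0 < s) (hx : x = s ^ 2)
    (hk0 : 0.99 * x ≤ k) (hk1 : k ≤ x) (hs1 : 1 ≤ s) :
    3 * (2 * s + 1) * (ζ / 16000 / s) ^ 2 * k + ζ / 16000 / s * (ζ / 450 * x) -
      ζ / 16000 / s * ((1 / (5 * x)) ^ 2 * (1 - 3 * (1 / (5 * x)) * (1.01 * x)) / 2 *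
        (1 - 2 * (1 / (5 * x)) * k) * k * (0.9 * ζ * x ^ 2)) ≤ -(ζ ^ 2 / 16000000 * s) := by
  have hx0 : 0 < x := by rw [hx]; positivity
  have h1 : 3 * (2 * s + 1) * (ζ / 16000 / s) ^ 2 * k ≤ 9 * (ζ / 16000) ^ 2 * s := by
    calc 3 * (2 * s + 1) * (ζ / 16000 / s) ^ 2 * k
        ≤ 3 * (3 * s) * (ζ / 16000 / s) ^ 2 * s ^ 2 := by
          have : 2 * s + 1 ≤ 3 * s := by linarith
          rw [hx] at hk1
          gcongr
          linarith
      _ = 9 * (ζ / 16000) ^ 2 * s := by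
          field_simp
          ring
  have h2 : ζ / 16000 / s * (ζ / 450 * x) = ζ / 16000 * (ζ / 450) * s := by
    rw [hx]
    field_simp
  have h3 : (1 / (5 * x)) ^ 2 * (1 - 3 * (1 / (5 * x)) * (1.01 * x)) / 2 = 0.00788 / x ^ 2 := by
    field_simp
    norm_num
  have h4 : 0.594 * x ≤ (1 - 2 * (1 / (5 * x)) * k) * k := by
    have e : 2 * (1 / (5 * x)) * k ≤ 0.4 := by
      rw [mul_one_div, div_mul_eq_mul_div, div_le_iff₀ (by positivity)]
      linarith
    calc 0.594 * x = 0.6 * (0.99 * x) := by ring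
      _ ≤ _ := mul_le_mul (by linarith) hk0 (by positivity) (by linarith)
  have h5 : ζ / 16000 * (0.0042 * ζ) * s ≤
      ζ / 16000 / s * ((1 / (5 * x)) ^ 2 * (1 - 3 * (1 / (5 * x)) * (1.01 * x)) / 2 *
        (1 - 2 * (1 / (5 * x)) * k) * k * (0.9 * ζ * x ^ 2)) := by
    rw [h3]
    calc ζ / 16000 * (0.0042 * ζ) * s
        ≤ ζ / 16000 / s * (0.00788 / x ^ 2 * (0.594 * x) * (0.9 * ζ * x ^ 2)) := by
          have e : ζ / 16000 / s * (0.00788 / x ^ 2 * (0.594 * x) * (0.9 * ζ * x ^ 2)) =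
              ζ / 16000 * (0.004212648 * ζ) * s := by
            rw [hx]
            field_simp
            norm_num
          rw [e]
          gcongr
          norm_num
      _ ≤ _ := by
          have e : 0.00788 / x ^ 2 * (0.594 * x) ≤
              0.00788 / x ^ 2 * (1 - 2 * (1 / (5 * x)) * k) * k := by
            rw [mul_assoc (0.00788 / x ^ 2)]
            exact mul_le_mul_of_nonneg_left h4 (by positivity)
          gcongr
  rw [h2]
  have h6 : 0 ≤ ζ ^ 2 * s := by positivity
  nlinarith

lemma LinearHG.exists_edgesThrough_le {H : Finset (Finset (Fin n))} (hH : LinearHG H) {ζ : ℝ}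
    {r : ℕ} (hζ0 : 0 < ζ) (hζ1 : ζ < 1) (hr : 100000 / ζ + 1 ≤ (r : ℝ))
    (hcard : ∀ e ∈ H, r ≤ #e) :
    ∃ d : ℕ, (∀ x, #(edgesThrough H x) ≤ d) ∧ d ≤ n ∧ (d : ℝ) * (r - 1) ≤ n ∧
      (d : ℝ) ≤ ζ / 100000 * n := by
  have hζr : 100000 ≤ ζ * (r - 1) := by
    have : 100000 / ζ ≤ (r : ℝ) - 1 := by linarith
    rw [div_le_iff₀ hζ0] at this
    linarith
  have hr1 : (100000 : ℝ) ≤ r - 1 := by nlinarith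
  have hr2 : 1 < r := by
    have : (1 : ℝ) < r := by linarith
    exact_mod_cast this
  have hdr : ((n / (r - 1) : ℕ) : ℝ) * (r - 1) ≤ n := by
    have h2 : ((n / (r - 1) * (r - 1) : ℕ) : ℝ) ≤ n := Nat.cast_le.mpr (Nat.div_mul_le_self _ _)
    rwa [Nat.cast_mul, Nat.cast_sub hr2.le, Nat.cast_one] at h2
  refine ⟨n / (r - 1), fun x => ?_, Nat.div_le_self _ _, hdr, ?_⟩
  · rw [Nat.le_div_iff_mul_le (by omega)]
    exact hH.card_edgesThrough_mul_le hcard x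
  · have hd0 : (0 : ℝ) ≤ ((n / (r - 1) : ℕ) : ℝ) := Nat.cast_nonneg _
    nlinarith

lemma card_lineNeighbors_le_mul {H : Finset (Finset (Fin n))} {ζ α : ℝ} {r d : ℕ} (hζ0 : 0 < ζ)
    (hζ1 : ζ < 1) (hα : 0 < α) (hα0 : α ≤ ζ / 100000)
    (hcard : ∀ e ∈ H, (#e : ℝ) ≤ (1 + α) * r) (hdeg : ∀ x, #(edgesThrough H x) ≤ d)
    (hdr : (d : ℝ) * (r - 1) ≤ n) (hdζ : (d : ℝ) ≤ ζ / 100000 * n) (e : Finset (Fin n)) :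
    (#(lineNeighbors H e) : ℝ) ≤ (1 + ζ / 20000) * n := by
  have hn0 : (0 : ℝ) ≤ n := Nat.cast_nonneg n
  by_cases he : e ∈ H
  · have h1 : (#(lineNeighbors H e) : ℝ) ≤ #e * d := by
      exact_mod_cast card_lineNeighbors_le hdeg e
    have h2 : (#e : ℝ) * d ≤ (1 + α) * r * d :=
      mul_le_mul_of_nonneg_right (hcard e he) (Nat.cast_nonneg d)
    have h3 : (r : ℝ) * d ≤ n + ζ / 100000 * n := by linarith
    calc (#(lineNeighbors H e) : ℝ) ≤ (1 + α) * (r * d) := by linarith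
      _ ≤ (1 + α) * (n + ζ / 100000 * n) := mul_le_mul_of_nonneg_left h3 (by linarith)
      _ = (1 + α) * (1 + ζ / 100000) * n := by ring
      _ ≤ (1 + ζ / 20000) * n := mul_le_mul_of_nonneg_right (by nlinarith) hn0
  · have : lineNeighbors H e = ∅ := Finset.filter_eq_empty_iff.mpr fun _ _ h => he h.1
    rw [this, Finset.card_empty, Nat.cast_zero]
    positivity

lemma LinearHG.mul_sq_le_card_nonadjPairs {H : Finset (Finset (Fin n))} (hH : LinearHG H)
    {ζ : ℝ} {d k : ℕ} (hζ0 : 0 < ζ) (hζ1 : ζ < 1) (hζn : 1000000 < ζ * n)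
    (hdeg : ∀ x, #(edgesThrough H x) ≤ d) (hdζ : (d : ℝ) ≤ ζ / 100000 * n)
    (hM : ∀ e ∈ H, (#e : ℝ) ≤ (1 - 0.99999 * ζ) * Real.sqrt n)
    (hk : (1 - ζ / 500) * n < k + 1) {e : Finset (Fin n)} (he : e ∈ H)
    (hke : k ≤ #(lineNeighbors H e)) :
    0.9 * ζ * (n : ℝ) ^ 2 ≤ #(nonadjPairs (lineNeighbors H) e H) := by
  have hn0 : (0 : ℝ) ≤ n := Nat.cast_nonneg n
  have hn1 : 1000000 < (n : ℝ) := by nlinarith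
  have hs0 := Real.sqrt_nonneg (n : ℝ)
  have hζ2 : 0 ≤ 1 - 0.99999 * ζ := by linarith
  set m := ⌊(1 - 0.99999 * ζ) * Real.sqrt n⌋₊ with hm
  have hms : (m : ℝ) ≤ (1 - 0.99999 * ζ) * Real.sqrt n := Nat.floor_le (mul_nonneg hζ2 hs0)
  have hm2 : (m : ℝ) * m ≤ (1 - 0.99999 * ζ) * n := by
    calc (m : ℝ) * m ≤ ((1 - 0.99999 * ζ) * Real.sqrt n) * ((1 - 0.99999 * ζ) * Real.sqrt n) :=
          mul_le_mul hms hms (Nat.cast_nonneg _) (mul_nonneg hζ2 hs0)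
      _ = (1 - 0.99999 * ζ) ^ 2 * n := by
          rw [mul_mul_mul_comm, Real.mul_self_sqrt hn0, sq]
      _ ≤ _ := mul_le_mul_of_nonneg_right (by nlinarith) hn0
  have h2 : (k : ℝ) ≤ #(lineNeighbors H e) := Nat.cast_le.mpr hke
  have hζn' : ζ * n ≤ n := mul_le_of_le_one_left hn0 hζ1.le
  refine le_trans ?_ (hH.le_card_nonadjPairs hdeg (m := m) (fun e he => Nat.le_floor (hM e he)) he)
  calc 0.9 * ζ * (n : ℝ) ^ 2 ≤ (0.99 * n) * (0.92 * ζ * n) := by nlinarith [sq_nonneg (n : ℝ)]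
    _ ≤ _ := mul_le_mul (by linarith) (by linarith) (by positivity) (Nat.cast_nonneg _)

lemma chromIndexLE_of_locally_sparse {ζ α : ℝ} (hζ0 : 0 < ζ) (hζ1 : ζ < 1) (hα : 0 < α)
    (hα0 : α ≤ ζ / 100000) {r : ℕ} (hn : 1000000 / ζ < n)
    (hn' : (120 / (ζ ^ 2 / 16000000) ^ 5) ^ 2 < (n : ℝ)) (hr : 100000 / ζ + 1 ≤ (r : ℝ))
    (hrn : (r : ℝ) ≤ (1 - ζ) * Real.sqrt n) {H : Finset (Finset (Fin n))} (hH : LinearHG H)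
    (hcard : ∀ e ∈ H, r ≤ #e ∧ (#e : ℝ) ≤ (1 + α) * r) {k : ℕ}
    (hk : (k : ℝ) ≤ (1 - ζ / 500) * n) (hk' : (1 - ζ / 500) * n < k + 1) :
    ChromIndexLE H k := by
  set s := Real.sqrt n with hs
  have hζn : 1000000 < ζ * n := by
    rw [div_lt_iff₀ hζ0] at hn
    linarith
  have hn0 : (1000000 : ℝ) < n := by nlinarith [Nat.cast_nonneg (α := ℝ) n]
  have hns : (n : ℝ) = s ^ 2 := (Real.sq_sqrt (Nat.cast_nonneg n)).symm
  have hs1 : 1 ≤ s := Real.one_le_sqrt.mpr (by linarith)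
  have hs0 : 0 < s := by linarith
  obtain ⟨d, hdeg, hdn, hdr, hdζ⟩ :=
    hH.exists_edgesThrough_le hζ0 hζ1 hr fun e he => (hcard e he).1
  have hr1 : 1 ≤ r := by
    have : (1 : ℝ) ≤ r := by linarith [div_pos (by norm_num : (0 : ℝ) < 100000) hζ0]
    exact_mod_cast this
  have hM : ∀ e ∈ H, (#e : ℝ) ≤ (1 - 0.99999 * ζ) * s := by
    intro e he
    refine (hcard e he).2.trans ?_
    calc (1 + α) * r ≤ (1 + α) * ((1 - ζ) * s) :=
          mul_le_mul_of_nonneg_left hrn (by linarith)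
      _ = ((1 + α) * (1 - ζ)) * s := by ring
      _ ≤ _ := mul_le_mul_of_nonneg_right (by nlinarith) hs0.le
  have hMs : ∀ e ∈ H, (#e : ℝ) ≤ s := fun e he => (hM e he).trans (by nlinarith)
  have hN := card_lineNeighbors_le_mul hζ0 hζ1 hα hα0 (fun e he => (hcard e he).2) hdeg hdr hdζ
  have hζn1 : ζ * n ≤ n := mul_le_of_le_one_left (by linarith) hζ1.le
  have hcoloring := exists_coloring_of_locally_sparse (H := H) (N := lineNeighbors H)
    (p := 1 / (5 * n)) (Δ := 1.01 * n) (t := ζ / 16000 / s) (M := s) (g := ζ / 450 * n)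
    (z := 0.9 * ζ * n ^ 2) (k := k) (fun e => Finset.filter_subset _ _)
    (fun e he => (mem_lineNeighbors.mp he).2.2.1 rfl) (fun _ _ => lineNeighbors_symm)
    (by positivity) (fun e => (hN e).trans (by linarith)) (by linarith)
    (by
      have : (n : ℝ) ≠ 0 := by linarith
      field_simp
      norm_num)
    (by linarith)
    (fun e S hS => by
      by_cases he : e ∈ H
      · exact le_trans (Nat.cast_le.mpr (card_isolatedPart_inter_lineNeighbors_le hS e))
          (hMs e he)
      · have : lineNeighbors H e = ∅ := Finset.filter_eq_empty_iff.mpr fun _ _ h => he h.1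
        rw [this, Finset.inter_empty, Finset.card_empty, Nat.cast_zero]
        exact hs0.le)
    hs0.le (by positivity)
    (by
      rw [div_mul_eq_mul_div, div_le_one hs0]
      linarith)
    (fun e he hke => hH.mul_sq_le_card_nonadjPairs hζ0 hζ1 hζn hdeg hdζ hM hk' he hke)
    (fun e _ => (hN e).trans_lt (by linarith))
    (by
      have hHn : (#H : ℝ) ≤ (n : ℝ) ^ 2 := by
        have h1 : #H ≤ n * d := card_le_mul_of_edgesThrough_le hdeg fun e he =>
          Finset.card_pos.mp (hr1.trans (hcard e he).1)
        have h3 : #H ≤ n ^ 2 := h1.trans ((Nat.mul_le_mul_left n hdn).trans (sq n).ge)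
        exact_mod_cast h3
      refine lt_of_le_of_lt (mul_le_mul hHn (Real.exp_le_exp.mpr
        (exponent_le hζ0 hs0 hns (by linarith) (by linarith) hs1)) (Real.exp_nonneg _)
        (by positivity)) ?_
      exact sq_mul_exp_neg_sqrt_lt_one (by positivity) (by linarith) hn')
  obtain ⟨φ, h1, h2⟩ := hcoloring
  exact ⟨φ, h1, fun e he f hf hne hef =>
    h2 e he f hf (mem_lineNeighbors.mpr ⟨hf, he, hne.symm, hef⟩)⟩

end Parameters

/-- An `n`-vertex linear hypergraph whose edge sizes all lie in `[r, (1+α)r]`, where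
`r ≤ (1-ζ)√n`, has chromatic index at most `(1 - ζ/500)n`. -/
theorem chrom_index_of_locally_sparse :
    ∀ ζ : ℝ, 0 < ζ → ζ < 1 →
      ∃ α0 : ℝ, 0 < α0 ∧ ∀ α : ℝ, 0 < α → α ≤ α0 →
        ∃ n0 rmin : ℕ, ∀ n : ℕ, n0 ≤ n →
          ∀ r : ℕ, rmin ≤ r → (r : ℝ) ≤ (1 - ζ) * Real.sqrt n →
            ∀ H : Finset (Finset (Fin n)), LinearHG H →
              (∀ e ∈ H, r ≤ e.card ∧ (e.card : ℝ) ≤ (1 + α) * r) →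
              ∃ k : ℕ, (k : ℝ) ≤ (1 - ζ / 500) * n ∧ ChromIndexLE H k := by
  intro ζ hζ0 hζ1
  refine ⟨ζ / 100000, by positivity, fun α hα hα0 => ?_⟩
  refine ⟨⌈1000000 / ζ + (120 / (ζ ^ 2 / 16000000) ^ 5) ^ 2⌉₊ + 1, ⌈100000 / ζ + 1⌉₊,
    fun n hn r hr hrn H hH hcard => ?_⟩
  have h1 : 1000000 / ζ + (120 / (ζ ^ 2 / 16000000) ^ 5) ^ 2 < n := Nat.lt_of_ceil_lt hn
  have h2 : 0 < 1000000 / ζ := by positivity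
  have h3 : 0 ≤ (120 / (ζ ^ 2 / 16000000) ^ 5) ^ 2 := sq_nonneg _
  have h4 : 0 ≤ (1 - ζ / 500) * n := mul_nonneg (by linarith) (Nat.cast_nonneg n)
  exact ⟨⌊(1 - ζ / 500) * n⌋₊, Nat.floor_le h4,
    chromIndexLE_of_locally_sparse hζ0 hζ1 hα hα0 (by linarith) (by linarith)
      (Nat.ceil_le.mp hr) hrn hH hcard (Nat.floor_le h4) (Nat.lt_floor_add_one _)⟩
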